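/- arXiv:1911.08858 — 3 statements merged into one kernel-verified Lean document; each statement's English description precedes it below -/
import Mathlib

section
/- Any topological embedding of the circle S¹ into the 2-sphere S² has a complement with at least two connected components. -/
open Set Filter Topology unitInterval in
/-- Logarithms propagate along homotopies of nonvanishing functions. -/
lemma jc_homotopy_log {X : Type} [TopologicalSpace X] (H : I × X → ℂ) (hH : Continuous H)
    (h0 : ∀ p, H p ≠ 0) (l : X → ℂ) (hl : Continuous l) (hl0 : ∀ x, Complex.exp (l x) = H (0, x)) :
    ∃ m : X → ℂ, Continuous m ∧ ∀ x, Complex.exp (m x) = H (1, x) := by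
  let H' : C(I × X, {z : ℂ // z ≠ 0}) := ⟨fun p => ⟨H p, h0 p⟩, by fun_prop⟩
  let l' : C(X, ℂ) := ⟨l, hl⟩
  have key : ∀ a, H' (0, a) = (fun z : ℂ ↦ (⟨_, z.exp_ne_zero⟩ : {z : ℂ // z ≠ 0})) (l' a) := by
    intro a
    apply Subtype.ext
    exact (hl0 a).symm
  refine ⟨fun x => Complex.isCoveringMap_exp.liftHomotopy H' l' key (1, x), by fun_prop, ?_⟩
  intro x
  have := congrFun (Complex.isCoveringMap_exp.liftHomotopy_lifts H' l' key) (1, x)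
  exact congrArg Subtype.val this

open Set Filter Topology unitInterval in
/-- An arc from `0` to `∞` allows a branch of the logarithm on its complement. -/
lemma jc_arc_log (g : ℝ → ℂ) (hg : ContinuousOn g (Ico 0 1))
    (hinv : ContinuousOn (fun t => (g t)⁻¹) (Ioc 0 1)) (g0 : g 0 = 0) (g1 : g 1 = 0)
    (gn : ∀ t ∈ Ioo (0 : ℝ) 1, g t ≠ 0) (X : Set ℂ) (hX : ∀ z ∈ X, ∀ t ∈ Icc (0 : ℝ) 1, g t ≠ z) :
    ∃ L : ℂ → ℂ, ContinuousOn L X ∧ ∀ z ∈ X, Complex.exp (L z) = z := by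
  have hhalf := gn (1/2) (by norm_num)
  obtain ⟨m, hm, hm1⟩ := jc_homotopy_log (X := X)
    (fun p => 1 - (p.2 : ℂ) * (g (1 - (p.1 : ℝ) / 2))⁻¹) (by
      refine continuous_const.sub ((by fun_prop : Continuous fun p : I × X => (p.2 : ℂ)).mul ?_)
      refine hinv.comp_continuous (f := fun p : I × X => 1 - (p.1 : ℝ) / 2) (by fun_prop) ?_
      rintro ⟨s, x⟩
      have := s.2.1
      have := s.2.2
      constructor <;> dsimp only <;> linarith) (by
      rintro ⟨s, x⟩ h
      have h1 := s.2.1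
      have h2 := s.2.2
      dsimp only at h
      by_cases hz : g (1 - (s : ℝ) / 2) = 0
      · simp [hz] at h
      · refine hX x x.2 (1 - (s : ℝ) / 2) ⟨by linarith, by linarith⟩ ?_
        have h3 := mul_inv_cancel₀ hz
        linear_combination g (1 - (s : ℝ) / 2) * h + (x : ℂ) * h3) (fun _ => 0) continuous_const (by
      intro x
      simp [g1])
  obtain ⟨m2, hm2, hm3⟩ := jc_homotopy_log (X := X)
    (fun p => (p.2 : ℂ) - g ((1 - (p.1 : ℝ)) / 2)) (by
      refine (by fun_prop : Continuous fun p : I × X => (p.2 : ℂ)).sub ?_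
      refine hg.comp_continuous (f := fun p : I × X => (1 - (p.1 : ℝ)) / 2) (by fun_prop) ?_
      rintro ⟨s, x⟩
      have := s.2.1
      have := s.2.2
      constructor <;> dsimp only <;> linarith) (by
      rintro ⟨s, x⟩ h
      have h1 := s.2.1
      have h2 := s.2.2
      dsimp only at h
      refine hX x x.2 ((1 - (s : ℝ)) / 2) ⟨by linarith, by linarith⟩ ?_
      linear_combination -h) (fun x => m x + Complex.log (-g (1/2))) (by fun_prop) (by
      intro x
      rw [Complex.exp_add, hm1, Complex.exp_log (neg_ne_zero.2 hhalf)]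
      have e1 : (1 : ℝ) - ((1 : I) : ℝ) / 2 = 1/2 := by norm_num
      have e2 : ((1 : ℝ) - ((0 : I) : ℝ)) / 2 = 1/2 := by norm_num
      simp only [e1, e2]
      field_simp
      ring)
  classical
  refine ⟨fun z => if h : z ∈ X then m2 ⟨z, h⟩ else 0, ?_, ?_⟩
  · rw [continuousOn_iff_continuous_domRestrict]
    convert hm2 using 1
    ext x
    simp [Set.domRestrict]
  · intro z hz
    simp only [hz, dif_pos]
    rw [hm3]
    simp [g0]

open Set Filter Topology in
/-- There is no continuous logarithm on the punctured plane. -/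
lemma jc_no_log (L : ℂ → ℂ) (hL : ContinuousOn L {0}ᶜ)
    (he : ∀ z : ℂ, z ≠ 0 → Complex.exp (L z) = z) : False := by
  have hc : Continuous fun t : ℝ => L (Complex.exp (t * Complex.I)) :=
    hL.comp_continuous (by fun_prop) (fun t => Complex.exp_ne_zero _)
  have := Complex.isCoveringMap_exp.const_of_comp
    (g := fun t : ℝ => L (Complex.exp (t * Complex.I)) - t * Complex.I) (hc.sub (by fun_prop)) (by
      intro a b
      apply Subtype.ext
      simp [Complex.exp_sub, he]) 0 (2 * Real.pi)
  simp only [Complex.ofReal_zero, zero_mul, Complex.exp_zero, sub_zero, Complex.ofReal_mul,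
    Complex.ofReal_ofNat, Complex.exp_two_pi_mul_I] at this
  apply Complex.two_pi_I_ne_zero
  linear_combination this

open Set Filter Topology in
lemma jc_glue (U V : Set ℂ) (hU : IsOpen U) (hV : IsOpen V) (hUV : ∀ z : ℂ, z ≠ 0 → z ∈ U ∨ z ∈ V)
    (hc : IsPreconnected (U ∩ V)) (LU LV : ℂ → ℂ) (cU : ContinuousOn LU U) (cV : ContinuousOn LV V)
    (eU : ∀ z ∈ U, Complex.exp (LU z) = z) (eV : ∀ z ∈ V, Complex.exp (LV z) = z) : False := by
  obtain ⟨c, hc1, hcc⟩ : ∃ c : ℂ, Complex.exp c = 1 ∧ ∀ z ∈ U ∩ V, LU z = LV z + c := by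
    rcases (U ∩ V).eq_empty_or_nonempty with h | ⟨a, ha⟩
    · exact ⟨0, by simp, by simp [h]⟩
    · have hz : ∀ z ∈ U ∩ V, Complex.exp (LU z - LV z) = 1 := by
        intro z hz
        rw [Complex.exp_sub, eU z hz.1, eV z hz.2]
        have : z ≠ 0 := by
          rw [← eU z hz.1]; exact Complex.exp_ne_zero _
        field_simp
      refine ⟨LU a - LV a, hz a ha, fun z hzz => ?_⟩
      have := Complex.isCoveringMap_exp.constOn_of_comp hc (g := fun z => LU z - LV z)
        ((cU.mono inter_subset_left).sub (cV.mono inter_subset_right)) (by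
          intro x hx y hy
          apply Subtype.ext
          simp only [hz x hx, hz y hy]) hzz ha
      linear_combination this
  classical
  refine jc_no_log (fun z => if z ∈ U then LU z else LV z + c) ?_ ?_
  · intro z hz
    apply ContinuousAt.continuousWithinAt
    rcases hUV z hz with h | h
    · refine (cU.continuousAt (hU.mem_nhds h)).congr ?_
      filter_upwards [hU.mem_nhds h] with x hx
      simp [hx]
    · refine ((cV.continuousAt (hV.mem_nhds h)).add (continuousAt_const (y := c))).congr ?_
      filter_upwards [hV.mem_nhds h] with x hx
      by_cases hxU : x ∈ U
      · simp [hxU, hcc x ⟨hxU, hx⟩]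
      · simp [hxU]
  · intro z hz
    by_cases h : z ∈ U
    · simp [h, eU z h]
    · have h2 := (hUV z hz).resolve_left h
      simp [h, Complex.exp_add, hc1, eV z h2]

open Set Filter Topology in
lemma jc_stereo (v w : Metric.sphere (0 : EuclideanSpace ℝ (Fin 3)) 1) (hvw : w ≠ v) :
    ∃ (φ : Metric.sphere (0 : EuclideanSpace ℝ (Fin 3)) 1 → ℂ)
      (ψ : ℂ → Metric.sphere (0 : EuclideanSpace ℝ (Fin 3)) 1),
      φ v = 0 ∧ φ w = 0 ∧ ContinuousOn φ {v}ᶜ ∧ ContinuousAt (fun x => (φ x)⁻¹) v ∧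
      Continuous ψ ∧ (∀ z, φ (ψ z) = z) ∧ (∀ z, ψ z ≠ v) ∧ ∀ x, x ≠ v → ψ (φ x) = x := by
  classical
  have : Fact (Module.finrank ℝ (EuclideanSpace ℝ (Fin 3)) = 2 + 1) := ⟨by simp⟩
  let e := stereographic' 2 v
  have hs : e.source = {v}ᶜ := stereographic'_source v
  have ht : e.target = univ := stereographic'_target v
  let T : EuclideanSpace ℝ (Fin 2) ≃ₜ ℂ :=
    Complex.orthonormalBasisOneI.repr.symm.toHomeomorph.trans
      (Homeomorph.addRight (-(Complex.orthonormalBasisOneI.repr.symm (e w))))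
  have hT : T (e w) = 0 := by simp [T]
  let φ : Metric.sphere (0 : EuclideanSpace ℝ (Fin 3)) 1 → ℂ := fun x => if x = v then 0 else T (e x)
  let ψ : ℂ → Metric.sphere (0 : EuclideanSpace ℝ (Fin 3)) 1 := fun z => e.symm (T.symm z)
  have hψv : ∀ z, ψ z ≠ v := by
    intro z
    have : ψ z ∈ e.source := e.map_target (by rw [ht]; trivial)
    rw [hs] at this
    exact this
  have hψc : Continuous ψ := by
    have := e.continuousOn_symm
    rw [ht] at this
    exact (continuousOn_univ.1 this).comp T.symm.continuous
  have hψφ : ∀ x, x ≠ v → ψ (φ x) = x := by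
    intro x hx
    simp only [φ, ψ, if_neg hx, Homeomorph.symm_apply_apply]
    exact e.left_inv (by rw [hs]; exact hx)
  refine ⟨φ, ψ, by simp [φ], by simp [φ, hvw, hT], ?_, ?_, hψc, ?_, hψv, hψφ⟩
  · have : ContinuousOn (fun x => T (e x)) {v}ᶜ := by
      rw [← hs]
      exact T.continuous.comp_continuousOn e.continuousOn
    refine this.congr ?_
    intro x hx
    simp only [φ]
    rw [if_neg (by simpa using hx)]
  · have hv : (φ v)⁻¹ = 0 := by simp [φ]
    rw [ContinuousAt, hv, Metric.tendsto_nhds]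
    intro ε hε
    have hK : IsCompact (ψ '' Metric.closedBall 0 ε⁻¹) :=
      (isCompact_closedBall 0 ε⁻¹).image hψc
    have hnv : v ∉ ψ '' Metric.closedBall 0 ε⁻¹ := by
      rintro ⟨z, -, hz⟩
      exact hψv z hz
    filter_upwards [hK.isClosed.isOpen_compl.mem_nhds hnv] with x hx
    by_cases hxv : x = v
    · rw [hxv, hv]; simpa using hε
    · have : ε⁻¹ < ‖φ x‖ := by
        by_contra hcon
        exact hx ⟨φ x, by simpa using not_lt.1 hcon, hψφ x hxv⟩
      rw [dist_zero_right, norm_inv]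
      exact inv_lt_of_inv_lt₀ hε this
  · intro z
    have h1 := hψv z
    simp only [φ, if_neg h1]
    simp only [ψ]
    rw [e.right_inv (by rw [ht]; trivial)]
    simp

open Set Filter Topology in
lemma jc_sphere_arc {S : Type} [TopologicalSpace S] (v w : S)
    (φ : S → ℂ) (ψ : ℂ → S)
    (hv : φ v = 0) (hw : φ w = 0) (hφ : ContinuousOn φ {v}ᶜ)
    (hφv : ContinuousAt (fun x => (φ x)⁻¹) v) [T1Space S]
    (hψv : ∀ z, ψ z ≠ v) (hψφ : ∀ x, x ≠ v → ψ (φ x) = x)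
    (γ : ℝ → S) (hγ : Continuous γ) (γ0 : γ 0 = w) (γ1 : γ 1 = v)
    (hne : ∀ t ∈ Ico (0 : ℝ) 1, γ t ≠ v) (hne' : ∀ t ∈ Ioc (0 : ℝ) 1, γ t ≠ w) :
    ∃ L : ℂ → ℂ, ContinuousOn L {z | ψ z ∉ γ '' Icc 0 1} ∧
      ∀ z ∈ {z | ψ z ∉ γ '' Icc 0 1}, Complex.exp (L z) = z := by
  have hwv : w ≠ v := by rw [← γ0]; exact hne 0 (by simp)
  have hnz : ∀ x, x ≠ v → x ≠ w → φ x ≠ 0 := by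
    intro x hx hxw h
    have h1 := hψφ x hx
    have h2 := hψφ w hwv
    rw [h, ← hw] at h1
    exact hxw (h1.symm.trans h2)
  refine jc_arc_log (fun t => φ (γ t)) ?_ ?_ ?_ ?_ ?_ _ ?_
  · exact hφ.comp hγ.continuousOn hne
  · intro t ht
    apply ContinuousAt.continuousWithinAt
    refine ContinuousAt.comp (f := γ) (g := fun x => (φ x)⁻¹) ?_ hγ.continuousAt
    by_cases h : γ t = v
    · rw [h]; exact hφv
    · exact (hφ.continuousAt (isOpen_compl_singleton.mem_nhds h)).inv₀ (hnz _ h (hne' t ht))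
  · simp [γ0, hw]
  · simp [γ1, hv]
  · intro t ht
    exact hnz _ (hne t ⟨ht.1.le, ht.2⟩) (hne' t ⟨ht.1, ht.2.le⟩)
  · rintro z hz t ht h
    apply hz
    by_cases hv' : γ t = v
    · refine ⟨0, by simp, ?_⟩
      rw [← h, hv', hv, γ0, ← hw, hψφ w hwv]
    · exact ⟨t, ht, by rw [← h, hψφ _ hv']⟩

/-- The point of the unit circle above (`s = 1`) or below (`s = -1`) the point `2t-1`. -/
noncomputable def jcPt (s : ℝ) (hs : s ^ 2 = 1) (t : ℝ) :
    Metric.sphere (0 : EuclideanSpace ℝ (Fin 2)) 1 :=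
  ⟨!₂[-Real.cos (Real.pi * t), s * Real.sin (Real.pi * t)], by
    rw [mem_sphere_zero_iff_norm, EuclideanSpace.norm_eq]
    simp [Fin.sum_univ_two, mul_pow, hs]⟩

lemma jcPt_continuous (s : ℝ) (hs : s ^ 2 = 1) : Continuous (jcPt s hs) := by
  unfold jcPt
  refine Continuous.subtype_mk ?_ _
  fun_prop

lemma jcPt_zero (s : ℝ) (hs : s ^ 2 = 1) (t : ℝ) :
    (jcPt s hs t).1 0 = -Real.cos (Real.pi * t) := by simp [jcPt]

lemma jcPt_one (s : ℝ) (hs : s ^ 2 = 1) (t : ℝ) :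
    (jcPt s hs t).1 1 = s * Real.sin (Real.pi * t) := by simp [jcPt]

lemma jcPt_ext (x y : Metric.sphere (0 : EuclideanSpace ℝ (Fin 2)) 1)
    (h0 : x.1 0 = y.1 0) (h1 : x.1 1 = y.1 1) : x = y := by
  apply Subtype.ext
  ext i
  fin_cases i
  · exact h0
  · exact h1

lemma jcPt_inj (s : ℝ) (hs : s ^ 2 = 1) (s' : ℝ) (hs' : s' ^ 2 = 1) (t t' : ℝ)
    (ht : t ∈ Set.Icc (0 : ℝ) 1)
    (ht' : t' ∈ Set.Icc (0 : ℝ) 1) (h : jcPt s hs t = jcPt s' hs' t') : t = t' := by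
  have h0 := congrArg (fun x => x.1 0) h
  simp only [jcPt_zero, neg_inj] at h0
  have hpi := Real.pi_pos
  have := Real.injOn_cos ⟨by nlinarith [ht.1], by nlinarith [ht.2]⟩
    ⟨by nlinarith [ht'.1], by nlinarith [ht'.2]⟩ h0
  exact mul_left_cancel₀ hpi.ne' this

lemma jcPt_surj (x : Metric.sphere (0 : EuclideanSpace ℝ (Fin 2)) 1) :
    ∃ t ∈ Set.Icc (0 : ℝ) 1, x = jcPt 1 (by norm_num) t ∨ x = jcPt (-1) (by norm_num) t := by
  have hx := x.2
  rw [mem_sphere_zero_iff_norm, EuclideanSpace.norm_eq, Real.sqrt_eq_one] at hx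
  simp only [Fin.sum_univ_two, Real.norm_eq_abs, sq_abs] at hx
  have hpi := Real.pi_pos
  have hcos : Real.cos (Real.arccos (-x.1 0)) = -x.1 0 :=
    Real.cos_arccos (by nlinarith [sq_nonneg (x.1 1)]) (by nlinarith [sq_nonneg (x.1 1)])
  have hsin : Real.sin (Real.arccos (-x.1 0)) = |x.1 1| := by
    rw [Real.sin_arccos, ← Real.sqrt_sq_eq_abs]
    congr 1
    linear_combination -hx
  have hmul : Real.pi * (Real.arccos (-x.1 0) / Real.pi) = Real.arccos (-x.1 0) := by
    field_simp
  refine ⟨Real.arccos (-x.1 0) / Real.pi, ⟨div_nonneg (Real.arccos_nonneg _) hpi.le,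
    (div_le_one hpi).2 (Real.arccos_le_pi _)⟩, ?_⟩
  rcases le_total 0 (x.1 1) with h | h
  · left
    apply jcPt_ext
    · rw [jcPt_zero, hmul, hcos, neg_neg]
    · rw [jcPt_one, hmul, hsin, abs_of_nonneg h, one_mul]
  · right
    apply jcPt_ext
    · rw [jcPt_zero, hmul, hcos, neg_neg]
    · rw [jcPt_one, hmul, hsin, abs_of_nonpos h]; ring

/-- Any topological embedding of the circle `S¹` into the 2-sphere `S²` has a
complement with at least two connected components (Jordan curve theorem on the sphere). -/
theorem jordan_curve_on_sphere
    (f : (Metric.sphere (0 : EuclideanSpace ℝ (Fin 2)) 1) →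
         (Metric.sphere (0 : EuclideanSpace ℝ (Fin 3)) 1))
    (hf : Continuous f) (hinj : Function.Injective f) :
    ¬ IsPreconnected ((Set.range f)ᶜ :
      Set (Metric.sphere (0 : EuclideanSpace ℝ (Fin 3)) 1)) := by
  intro hpre
  have s1 : (1 : ℝ) ^ 2 = 1 := by norm_num
  have s2 : (-1 : ℝ) ^ 2 = 1 := by norm_num
  have hp0 : jcPt (-1) s2 0 = jcPt 1 s1 0 := by
    apply jcPt_ext <;> simp [jcPt_zero, jcPt_one]
  have hp1 : jcPt (-1) s2 1 = jcPt 1 s1 1 := by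
    apply jcPt_ext <;> simp [jcPt_zero, jcPt_one]
  obtain ⟨φ, ψ, hv, hw, hφ, hφv, hψc, hφψ, hψv, hψφ⟩ :=
    jc_stereo (f (jcPt 1 s1 1)) (f (jcPt 1 s1 0)) (by
      intro h
      have := jcPt_inj _ _ _ _ _ _ (by simp) (by simp) (hinj h)
      norm_num at this)
  have arc : ∀ (s : ℝ) (hs : s ^ 2 = 1), jcPt s hs 0 = jcPt 1 s1 0 → jcPt s hs 1 = jcPt 1 s1 1 → _ :=
    fun s hs h0 h1 => jc_sphere_arc (f (jcPt 1 s1 1)) (f (jcPt 1 s1 0)) φ ψ hv hw hφ hφv hψv hψφ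
      (fun t => f (jcPt s hs t)) (hf.comp (jcPt_continuous s hs)) (congrArg f h0) (congrArg f h1)
      (by
        intro t ht h
        have := jcPt_inj _ _ _ _ _ _ ⟨ht.1, ht.2.le⟩ (by simp) (hinj h)
        exact ht.2.ne this)
      (by
        intro t ht h
        have := jcPt_inj _ _ _ _ _ _ ⟨ht.1.le, ht.2⟩ (by simp) (hinj h)
        exact ht.1.ne' this)
  obtain ⟨LU, cU, eU⟩ := arc 1 s1 rfl rfl
  obtain ⟨LV, cV, eV⟩ := arc (-1) s2 hp0 hp1
  have hopen : ∀ (s : ℝ) (hs : s ^ 2 = 1),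
      IsOpen {z | ψ z ∉ (fun t => f (jcPt s hs t)) '' Set.Icc 0 1} := by
    intro s hs
    have : IsCompact ((fun t => f (jcPt s hs t)) '' Set.Icc 0 1) :=
      isCompact_Icc.image (hf.comp (jcPt_continuous s hs))
    exact this.isClosed.isOpen_compl.preimage hψc
  refine jc_glue _ _ (hopen 1 s1) (hopen (-1) s2) ?_ ?_ LU LV cU cV eU eV
  · intro z hz
    by_contra hcon
    simp only [Set.mem_ofPred_eq, not_or, not_not] at hcon
    obtain ⟨⟨t, ht, h⟩, ⟨t', ht', h'⟩⟩ := hcon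
    dsimp only at h h'
    have hpt := hinj (h.trans h'.symm)
    have htt := jcPt_inj _ _ _ _ _ _ ht ht' hpt
    subst htt
    have hsin := congrArg (fun x => x.1 1) hpt
    simp only [jcPt_one] at hsin
    have hsin0 : Real.sin (Real.pi * t) = 0 := by linarith
    have hpi := Real.pi_pos
    rcases ht.1.eq_or_lt with h0 | h0
    · subst h0
      apply hz
      rw [← hφψ z, ← h, hw]
    · rcases ht.2.eq_or_lt with h1 | h1
      · subst h1
        exact hψv z h.symm
      · exact (Real.sin_pos_of_pos_of_lt_pi (by positivity) (by nlinarith)).ne' hsin0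
  · have himg := hpre.image φ (hφ.mono (by
      intro x hx hxv
      exact hx ⟨_, (Set.mem_singleton_iff.1 hxv).symm⟩))
    convert himg using 1
    ext z
    constructor
    · rintro ⟨h1, h2⟩
      refine ⟨ψ z, ?_, hφψ z⟩
      rintro ⟨x, hx⟩
      obtain ⟨t, ht, h | h⟩ := jcPt_surj x
      · exact h1 ⟨t, ht, by rw [← hx, h]⟩
      · exact h2 ⟨t, ht, by rw [← hx, h]⟩
    · rintro ⟨x, hx, rfl⟩
      have hxv : x ≠ f (jcPt 1 s1 1) := fun h => hx ⟨_, h.symm⟩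
      constructor
      · rintro ⟨t, ht, h⟩
        rw [hψφ x hxv] at h
        exact hx ⟨_, h⟩
      · rintro ⟨t, ht, h⟩
        rw [hψφ x hxv] at h
        exact hx ⟨_, h⟩
end

section
/- Every continuous locally injective map f : S¹ → ℝ² has an image whose complement in ℝ² is disconnected. -/
open Set Topology

namespace ImmersedCircle

/-- A continuous injective image of a compact subset of the line has empty interior. -/
lemma arc_interior (F : ℝ → ℂ) (hF : Continuous F) (K : Set ℝ) (hK : IsCompact K)
    (hinj : InjOn F K) : interior (F '' K) = ∅ := by
  by_contra hne
  obtain ⟨c, hc⟩ := nonempty_iff_ne_empty.mpr hne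
  obtain ⟨r, hr, hball⟩ := Metric.isOpen_iff.mp isOpen_interior c hc
  have hsub : Metric.ball c r ⊆ F '' K := hball.trans interior_subset
  let g := Function.invFunOn F K
  have hgK : ∀ z ∈ F '' K, g z ∈ K := fun z hz => Function.invFunOn_mem hz
  have hFg : ∀ z ∈ F '' K, F (g z) = z := fun z hz => Function.invFunOn_eq hz
  have hg : ContinuousOn g (F '' K) := by
    rw [continuousOn_iff_isClosed]
    intro C hC
    refine ⟨F '' (K ∩ C), ((hK.inter_right hC).image hF).isClosed, ?_⟩
    ext z
    constructor
    · rintro ⟨h1, h2⟩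
      exact ⟨⟨g z, ⟨hgK z h2, h1⟩, hFg z h2⟩, h2⟩
    · rintro ⟨⟨x, ⟨hx, hxC⟩, rfl⟩, h2⟩
      refine ⟨?_, h2⟩
      have : g (F x) = x := hinj (hgK _ h2) hx (hFg _ h2)
      simpa [this] using hxC
  let e : ℝ → ℂ := fun θ => c + (r / 2 : ℝ) * Complex.exp (θ * Complex.I)
  have he : Continuous e := by fun_prop
  have hemem : ∀ θ, e θ ∈ F '' K := by
    intro θ
    apply hsub
    simp only [e, Metric.mem_ball, dist_eq_norm, add_sub_cancel_left, norm_mul,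
      Complex.norm_exp_ofReal_mul_I, Complex.norm_real, mul_one, Real.norm_eq_abs]
    rw [abs_of_pos (by linarith)]; linarith
  have hh : Continuous (fun θ => g (e θ)) := hg.comp_continuous he hemem
  have hk : Continuous (fun θ => g (e θ) - g (e (θ + Real.pi))) := by
    exact hh.sub (hh.comp (continuous_id.add continuous_const))
  have hper : e (Real.pi + Real.pi) = e 0 := by
    simp only [e]
    congr 2
    push_cast
    rw [show ((Real.pi : ℂ) + Real.pi) * Complex.I = 2 * Real.pi * Complex.I by ring,
      Complex.exp_two_pi_mul_I]
    simp
  have hz : ∃ θ, g (e θ) - g (e (θ + Real.pi)) = 0 := by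
    have := mem_range_of_exists_le_of_exists_ge hk (c := 0)
    rcases le_total (g (e 0) - g (e (0 + Real.pi))) 0 with h | h
    · refine this ⟨0, h⟩ ⟨Real.pi, ?_⟩
      simp only [hper]; simp only [zero_add] at h; linarith
    · refine this ⟨Real.pi, ?_⟩ ⟨0, h⟩
      simp only [hper]; simp only [zero_add] at h; linarith
  obtain ⟨θ, hθ⟩ := hz
  have h1 : e θ = e (θ + Real.pi) := by
    rw [← hFg _ (hemem θ), ← hFg _ (hemem (θ + Real.pi)), sub_eq_zero.mp hθ]
  simp only [e, add_right_inj] at h1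
  have h2 := mul_left_cancel₀ (by simp; positivity) h1
  rw [show ((θ + Real.pi : ℝ) : ℂ) * Complex.I = θ * Complex.I + Real.pi * Complex.I by
    push_cast; ring, Complex.exp_add, Complex.exp_pi_mul_I] at h2
  have h3 := Complex.exp_ne_zero (θ * Complex.I)
  apply h3
  linear_combination h2 / 2

/-- A continuous logarithm of `(z - γ 0) / (z - γ 1)` off the image of a path. -/
lemma log_off_arc (γ : ℝ → ℂ) (hγ : Continuous γ) (u v : ℝ) (huv : u ≤ v) :
    ∃ L : ℂ → ℂ, ContinuousOn L (γ '' Icc u v)ᶜ ∧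
      ∀ z ∈ (γ '' Icc u v)ᶜ, Complex.exp (L z) = (z - γ v) / (z - γ u) := by
  classical
  let A := ((γ '' Icc u v)ᶜ : Set ℂ)
  have hmem : ∀ t : unitInterval, u + t * (v - u) ∈ Icc u v := by
    intro t
    have h0 := t.2.1
    have h1 := t.2.2
    constructor <;> nlinarith
  have hne : ∀ (t : unitInterval) (z : A), (z : ℂ) - γ (u + t * (v - u)) ≠ 0 := by
    intro t z h
    exact z.2 ⟨_, hmem t, (sub_eq_zero.mp h).symm⟩
  have hne0 : ∀ z : A, (z : ℂ) - γ u ≠ 0 := by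
    intro z
    simpa using hne 0 z
  let H : C(unitInterval × A, {z : ℂ // z ≠ 0}) :=
    ⟨fun p => ⟨((p.2 : ℂ) - γ (u + p.1 * (v - u))) / ((p.2 : ℂ) - γ u),
      div_ne_zero (hne _ _) (hne0 _)⟩, by
      refine Continuous.subtype_mk (Continuous.div (by fun_prop) (by fun_prop) ?_) _
      intro p; exact hne0 _⟩
  have H0 : ∀ a, H (0, a) = (⟨_, (Complex.exp_ne_zero ((ContinuousMap.const A (0:ℂ)) a))⟩ :
      {z : ℂ // z ≠ 0}) := by
    intro a
    apply Subtype.ext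
    simp [H, hne0 a]
  let Γ := Complex.isCoveringMap_exp.liftHomotopy H (ContinuousMap.const A 0) H0
  have hΓ := Complex.isCoveringMap_exp.liftHomotopy_lifts H (ContinuousMap.const A 0) H0
  refine ⟨fun z => if h : z ∈ A then Γ (1, ⟨z, h⟩) else 0, ?_, ?_⟩
  · rw [continuousOn_iff_continuous_domRestrict]
    have : Continuous fun z : A => Γ (1, z) := by fun_prop
    convert this using 1
    ext z
    have hz : (z : ℂ) ∈ A := z.2
    simp only [domRestrict_apply, hz, dif_pos, Subtype.coe_eta]
  · intro z hz
    have hzA : z ∈ A := hz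
    have := congrArg Subtype.val (congrFun hΓ (1, ⟨z, hz⟩))
    simp only [hzA, dif_pos]
    refine Eq.trans this ?_
    simp [H]

/-- `(z - b) / (z - a)` has no continuous logarithm on the plane minus `a, b`. -/
lemma no_log (a b : ℂ) (hab : a ≠ b) (L : ℂ → ℂ) (hL : ContinuousOn L {a, b}ᶜ)
    (hexp : ∀ z ∈ ({a, b}ᶜ : Set ℂ), Complex.exp (L z) = (z - b) / (z - a)) : False := by
  have hab0 : a - b ≠ 0 := sub_ne_zero.mpr hab
  let e : ℝ → ℂ := fun θ => a + (a - b) / 2 * Complex.exp (θ * Complex.I)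
  have he : Continuous e := by fun_prop
  have hexpne : ∀ θ : ℝ, Complex.exp (θ * Complex.I) ≠ 0 := fun θ => Complex.exp_ne_zero _
  have hre : ∀ θ : ℝ, 0 < (1 + Complex.exp (θ * Complex.I) / 2).re := by
    intro θ
    have h1 := Complex.abs_re_le_norm (Complex.exp (θ * Complex.I))
    rw [Complex.norm_exp_ofReal_mul_I] at h1
    have := (abs_le.mp h1).1
    have h2 : (1 + Complex.exp (θ * Complex.I) / 2).re
        = 1 + (Complex.exp (θ * Complex.I)).re / 2 := by
      rw [Complex.add_re, Complex.one_re]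
      norm_num
    rw [h2]; linarith
  have hslit : ∀ θ : ℝ, (1 + Complex.exp (θ * Complex.I) / 2) ∈ Complex.slitPlane :=
    fun θ => Or.inl (hre θ)
  have heb : ∀ θ, e θ - b = (a - b) * (1 + Complex.exp (θ * Complex.I) / 2) := by
    intro θ; simp only [e]; ring
  have hea : ∀ θ, e θ - a = (a - b) / 2 * Complex.exp (θ * Complex.I) := by
    intro θ; simp only [e]; ring
  have hmem : ∀ θ, e θ ∈ ({a, b}ᶜ : Set ℂ) := by
    intro θ h
    rcases h with h | h
    · have := hea θ
      rw [h, sub_self] at this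
      exact mul_ne_zero (div_ne_zero hab0 two_ne_zero) (hexpne θ) this.symm
    · have := heb θ
      rw [h, sub_self] at this
      exact mul_ne_zero hab0 (Complex.slitPlane_ne_zero (hslit θ)) this.symm
  let M : ℝ → ℂ := fun θ => L (e θ) - Complex.log (1 + Complex.exp (θ * Complex.I) / 2)
    + θ * Complex.I
  have hM : Continuous M := by
    refine ((hL.comp_continuous he hmem).sub ?_).add (by fun_prop)
    exact Continuous.clog (by fun_prop) hslit
  have hexpM : ∀ θ, Complex.exp (M θ) = 2 := by
    intro θ
    simp only [M]
    rw [Complex.exp_add, Complex.exp_sub, hexp _ (hmem θ),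
      Complex.exp_log (Complex.slitPlane_ne_zero (hslit θ)), heb, hea]
    have := hexpne θ
    have h2 := Complex.slitPlane_ne_zero (hslit θ)
    generalize Complex.exp (θ * Complex.I) = w at this h2 ⊢
    have h3 : 2 + w ≠ 0 := fun h => h2 (by linear_combination h / 2)
    field_simp
  have hconst : M 0 = M (2 * Real.pi) := by
    refine Complex.isCoveringMap_exp.const_of_comp hM ?_ 0 (2 * Real.pi)
    intro x y
    apply Subtype.ext
    simp only [hexpM]
  have h0 : Complex.exp (((2 * Real.pi : ℝ) : ℂ) * Complex.I) = 1 := by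
    push_cast; exact Complex.exp_two_pi_mul_I
  simp only [M, e, h0] at hconst
  simp at hconst

/-- A simple closed curve separates the plane. -/
lemma jordan (γ : ℝ → ℂ) (hγ : Continuous γ) (s m t : ℝ) (hsm : s < m) (hmt : m < t)
    (hcl : γ s = γ t)
    (hinj : ∀ x y, s ≤ x → x < y → y ≤ t → γ x = γ y → x = s ∧ y = t) :
    ¬ IsPreconnected ((γ '' Icc s t)ᶜ : Set ℂ) := by
  classical
  intro hcon
  obtain ⟨L₁, hL₁, he₁⟩ := log_off_arc γ hγ s m hsm.le
  obtain ⟨L₃, hL₃, he₃⟩ := log_off_arc γ hγ m t hmt.le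
  let A := γ '' Icc s m
  let B := γ '' Icc m t
  have hAB : γ '' Icc s t = A ∪ B := by
    rw [← image_union, Icc_union_Icc_eq_Icc hsm.le hmt.le]
  have hAo : IsOpen Aᶜ := (isCompact_Icc.image hγ).isClosed.isOpen_compl
  have hBo : IsOpen Bᶜ := (isCompact_Icc.image hγ).isClosed.isOpen_compl
  have hne : γ s ≠ γ m := fun h => by
    have := hinj s m le_rfl hsm hmt.le h
    linarith [this.2]
  have hint : A ∩ B ⊆ {γ s, γ m} := by
    rintro z ⟨⟨x, hx, rfl⟩, ⟨y, hy, hxy⟩⟩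
    rcases (hx.2.trans hy.1).eq_or_lt with h | h
    · have : x = m := le_antisymm hx.2 (by rw [h]; exact hy.1)
      simp [this]
    · have := hinj x y hx.1 h hy.2 hxy.symm
      simp [this.1]
  -- correct the second log
  let L₂ : ℂ → ℂ := fun z => - L₃ z
  have he₂ : ∀ z ∈ Bᶜ, Complex.exp (L₂ z) = (z - γ m) / (z - γ s) := by
    intro z hz
    simp only [L₂, Complex.exp_neg, he₃ z hz, hcl, inv_div]
  have hL₂ : ContinuousOn L₂ Bᶜ := hL₃.neg
  have hd : ∃ k : ℂ, Complex.exp k = 1 ∧ ∀ z ∈ Aᶜ ∩ Bᶜ, L₁ z - L₂ z = k := by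
    rcases (Aᶜ ∩ Bᶜ).eq_empty_or_nonempty with h | ⟨w, hw⟩
    · exact ⟨0, by simp, by simp [h]⟩
    have hone : ∀ z ∈ Aᶜ ∩ Bᶜ, Complex.exp (L₁ z - L₂ z) = 1 := by
      intro z hz
      rw [Complex.exp_sub, he₁ z hz.1, ← he₂ z hz.2, div_self (Complex.exp_ne_zero _)]
    refine ⟨_, hone w hw, fun z hz => ?_⟩
    rw [hAB, compl_union] at hcon
    refine Complex.isCoveringMap_exp.constOn_of_comp hcon
      ((hL₁.mono inter_subset_left).sub (hL₂.mono inter_subset_right)) ?_ hz hw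
    intro x hx y hy
    apply Subtype.ext
    simp only [Pi.sub_apply, hone x hx, hone y hy]
  obtain ⟨k, hk1, hk⟩ := hd
  let L : ℂ → ℂ := fun z => if z ∈ A then L₂ z + k else L₁ z
  have hLA : ∀ z ∈ Aᶜ, L z = L₁ z := fun z hz => if_neg hz
  have hLB : ∀ z ∈ Bᶜ, L z = L₂ z + k := by
    intro z hz
    by_cases h : z ∈ A
    · exact if_pos h
    · rw [hLA z h, ← hk z ⟨h, hz⟩]; ring
  have hcase : ∀ z ∈ ({γ s, γ m}ᶜ : Set ℂ), z ∈ Aᶜ ∨ z ∈ Bᶜ := by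
    intro z hz
    by_contra h
    push Not at h
    exact hz (hint ⟨not_not.mp h.1, not_not.mp h.2⟩)
  refine no_log (γ s) (γ m) hne L ?_ ?_
  · intro z hz
    apply ContinuousAt.continuousWithinAt
    rcases hcase z hz with h | h
    · exact ((hL₁.congr hLA).continuousAt (hAo.mem_nhds h))
    · exact (((hL₂.add continuousOn_const).congr hLB).continuousAt (hBo.mem_nhds h))
  · intro z hz
    rcases hcase z hz with h | h
    · rw [hLA z h, he₁ z h]
    · rw [hLB z h, Complex.exp_add, hk1, mul_one, he₂ z h]

/-- A closed immersed curve contains a simple closed subloop. -/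
lemma exists_loop (F : ℝ → ℂ) (hF : Continuous F) (T : ℝ) (hT : 0 < T)
    (hper : ∀ t, F (t + T) = F t) (hloc : ∀ t, ∃ U ∈ 𝓝 t, InjOn F U) :
    ∃ s t, s < t ∧ F s = F t ∧
      ∀ x y, s ≤ x → x < y → y ≤ t → F x = F y → x = s ∧ y = t := by
  let V : Set (ℝ × ℝ) := {p | ∃ U, IsOpen U ∧ InjOn F U ∧ p.1 ∈ U ∧ p.2 ∈ U}
  have hV : IsOpen V := by
    have : V = ⋃ U ∈ {U | IsOpen U ∧ InjOn F U}, U ×ˢ U := by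
      ext p
      simp only [V, mem_iUnion, mem_prod, mem_ofPred_eq, exists_prop, and_assoc]
    rw [this]
    exact isOpen_biUnion fun U hU => hU.1.prod hU.1
  have hdiag : ∀ x, (x, x) ∈ V := by
    intro x
    obtain ⟨U, hU, hi⟩ := hloc x
    obtain ⟨W, hWU, hWo, hxW⟩ := mem_nhds_iff.mp hU
    exact ⟨W, hWo, hi.mono hWU, hxW, hxW⟩
  have hVne : ∀ x y, x < y → F x = F y → (x, y) ∉ V := by
    rintro x y hxy h ⟨U, -, hi, hx, hy⟩
    exact hxy.ne (hi hx hy h)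
  let S : Set (ℝ × ℝ) := (Icc 0 T ×ˢ Icc 0 (2 * T)) ∩
    ({p | p.1 ≤ p.2} ∩ {p | F p.1 = F p.2} ∩ Vᶜ)
  have hS : IsCompact S := by
    refine (isCompact_Icc.prod isCompact_Icc).inter_right ?_
    refine ((isClosed_le (by fun_prop) (by fun_prop)).inter
      (isClosed_eq (by fun_prop) (by fun_prop))).inter hV.isClosed_compl
  have h0T : F 0 = F T := by simpa using (hper 0).symm
  have hSne : S.Nonempty := by
    refine ⟨(0, T), ⟨⟨⟨le_rfl, hT.le⟩, ⟨hT.le, by linarith⟩⟩, ⟨hT.le, h0T⟩, hVne 0 T hT h0T⟩⟩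
  obtain ⟨⟨s, t⟩, hst, hmin⟩ := hS.exists_isMinOn hSne
    (f := fun p => p.2 - p.1) (by fun_prop)
  obtain ⟨⟨hs, ht⟩, ⟨hle, hFst⟩, hnV⟩ := hst
  simp only [mem_Icc, mem_ofPred_eq] at hs ht hle hFst
  have hlt : s < t := by
    refine lt_of_le_of_ne hle ?_
    rintro rfl
    exact hnV (hdiag s)
  refine ⟨s, t, hlt, hFst, ?_⟩
  intro x y hsx hxy hyt hFxy
  have key : t - s ≤ y - x := by
    rcases le_total x T with h | h
    · have : (x, y) ∈ S := ⟨⟨⟨by linarith, h⟩, ⟨by linarith, by linarith⟩⟩,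
        ⟨hxy.le, hFxy⟩, hVne x y hxy hFxy⟩
      exact hmin this
    · have hFT : F (x - T) = F (y - T) := by
        rw [← hper (x - T), ← hper (y - T)]; simpa using hFxy
      have : (x - T, y - T) ∈ S := ⟨⟨⟨by dsimp; linarith, by dsimp; linarith⟩,
        ⟨by dsimp; linarith, by dsimp; linarith⟩⟩,
        ⟨by dsimp; linarith, hFT⟩, hVne _ _ (by linarith) hFT⟩
      have := hmin this
      simp only [mem_ofPred_eq] at this
      linarith
  constructor <;> linarith

/-- The main theorem for periodic curves in the complex plane. -/
lemma main (F : ℝ → ℂ) (hF : Continuous F) (T : ℝ) (hT : 0 < T)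
    (hper : ∀ t, F (t + T) = F t) (hloc : ∀ t, ∃ U ∈ 𝓝 t, InjOn F U) :
    ¬ IsPreconnected ((range F)ᶜ : Set ℂ) := by
  intro hcon
  have hrange : range F = F '' Icc 0 T := by
    have hp : Function.Periodic F T := hper
    have := hp.image_Icc hT 0
    rw [zero_add] at this
    exact this.symm
  have hnd : IsNowhereDense (F '' Icc 0 T) := by
    refine isCompact_Icc.induction_on (p := fun s => IsNowhereDense (F '' s)) ?_ ?_ ?_ ?_
    · simp
    · intro s t hst ht
      exact ht.mono (image_mono hst)
    · intro s t hs ht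
      rw [image_union, IsNowhereDense, closure_union,
        interior_union_isClosed_of_interior_empty isClosed_closure ht]
      exact hs
    · intro x _
      obtain ⟨U, hU, hi⟩ := hloc x
      obtain ⟨K, hK, hKU, hKc⟩ := local_compact_nhds hU
      refine ⟨K, mem_nhdsWithin_of_mem_nhds hK, ?_⟩
      rw [(hKc.image hF).isClosed.isNowhereDense_iff]
      exact arc_interior F hF K hKc (hi.mono hKU)
  have hdense : Dense ((range F)ᶜ) := by
    rw [hrange]
    rw [(isCompact_Icc.image hF).isClosed.isNowhereDense_iff] at hnd
    exact interior_eq_empty_iff_dense_compl.mp hnd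
  obtain ⟨s, t, hst, hcl, hinj⟩ := exists_loop F hF T hT hper hloc
  refine jordan F hF s ((s + t) / 2) t (by linarith) (by linarith) hcl hinj ?_
  refine hcon.subset_closure (compl_subset_compl.mpr (image_subset_range _ _)) ?_
  rw [hdense.closure_eq]
  exact subset_univ _

end ImmersedCircle

/-- Every continuous locally injective map `f : S¹ → ℝ²` (a topological immersion)
has an image whose complement in `ℝ²` is disconnected. -/
theorem immersed_circle_separates_plane
    (f : (Metric.sphere (0 : EuclideanSpace ℝ (Fin 2)) 1) → EuclideanSpace ℝ (Fin 2))
    (hf : Continuous f)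
    (hloc : ∀ x, ∃ U ∈ nhds x, Set.InjOn f U) :
    ¬ IsPreconnected ((Set.range f)ᶜ : Set (EuclideanSpace ℝ (Fin 2))) := by
  intro hcon
  let φ := Complex.orthonormalBasisOneI.repr
  let e : ℝ → Metric.sphere (0 : EuclideanSpace ℝ (Fin 2)) 1 := fun t =>
    ⟨φ (Circle.exp t : ℂ), by simp [φ.norm_map]⟩
  have he : Continuous e := by
    refine Continuous.subtype_mk (φ.continuous.comp ?_) _
    exact continuous_subtype_val.comp Circle.exp.continuous
  have hesurj : Function.Surjective e := by
    rintro ⟨x, hx⟩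
    have hn : ‖φ.symm x‖ = 1 := by simpa [φ.symm.norm_map] using hx
    refine ⟨Complex.arg (φ.symm x), Subtype.ext ?_⟩
    have : ((Circle.exp (Complex.arg (φ.symm x)) : Circle) : ℂ) = φ.symm x := by
      have h := Complex.norm_mul_exp_arg_mul_I (φ.symm x)
      rw [hn] at h
      simpa [Circle.coe_exp] using h
    simp only [e, this]
    simp
  have heinj : ∀ x y, e x = e y → Circle.exp x = Circle.exp y := by
    intro x y h
    exact Subtype.ext (φ.injective (congrArg Subtype.val h))
  refine ImmersedCircle.main (fun t => φ.symm (f (e t)))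
    (φ.symm.continuous.comp (hf.comp he)) (2 * Real.pi) Real.two_pi_pos ?_ ?_ ?_
  · intro t
    have : e (t + 2 * Real.pi) = e t := by
      apply Subtype.ext
      simp [e, Circle.exp_add, Circle.exp_two_pi]
    simp only [this]
  · intro t
    obtain ⟨U, hU, hi⟩ := hloc (e t)
    obtain ⟨W, hWo, htW, hWi⟩ :=
      Circle.isCoveringMap_exp.isLocalHomeomorph.isLocallyInjective t
    refine ⟨W ∩ e ⁻¹' U, Filter.inter_mem (hWo.mem_nhds htW) (he.continuousAt hU), ?_⟩
    intro x hx y hy hxy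
    exact hWi hx.1 hy.1 (heinj x y (hi hx.2 hy.2 (φ.symm.injective hxy)))
  · have : (range fun t => φ.symm (f (e t)))ᶜ = φ.symm '' (range f)ᶜ := by
      rw [image_compl_eq φ.symm.bijective, ← range_comp]
      congr 1
      exact hesurj.range_comp (fun x => φ.symm (f x))
    rw [this]
    exact hcon.image _ φ.symm.continuous.continuousOn
end

section
/- Let Y be a compact subset of the open n-disk (interior of D^n) such that D^n deformation retracts onto Y. Then Y is connected and the complement D^n \ Y is connected. -/
open Set Metric Topology MeasureTheory

theorem aux_contract {E : Type*} [NormedAddCommGroup E] [NormedSpace ℝ E] [CompleteSpace E]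
    (u : E → E) (K : NNReal) (hK : K < 1) (hu : LipschitzWith K u) :
    Function.Bijective (fun x => x + u x) := by
  constructor
  · intro x y h
    have h1 : x - y = u y - u x := by
      have h' : x + u x = y + u y := h
      rw [sub_eq_sub_iff_add_eq_add, h', add_comm]
    have h2 := hu.dist_le_mul y x
    rw [dist_eq_norm, ← h1, dist_comm, dist_eq_norm] at h2
    have hK' : (K : ℝ) < 1 := hK
    have h3 : ‖x - y‖ = 0 := by
      nlinarith [norm_nonneg (x - y)]
    exact sub_eq_zero.1 (norm_eq_zero.1 h3)
  · intro y
    have hc : ContractingWith K (fun x => y - u x) := by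
      refine ⟨hK, LipschitzWith.of_dist_le_mul fun a b => ?_⟩
      rw [dist_sub_left]
      exact hu.dist_le_mul a b
    have := hc.fixedPoint_isFixedPt
    refine ⟨hc.fixedPoint, ?_⟩
    have h : y - u hc.fixedPoint = hc.fixedPoint := this
    show hc.fixedPoint + u hc.fixedPoint = y
    rw [← sub_eq_iff_eq_add.1 h]

theorem aux_lip {E : Type*} [NormedAddCommGroup E] [NormedSpace ℝ E]
    (w : E → E) (R : ℝ) (K : NNReal) (hw : LipschitzOnWith K w (closedBall 0 R))
    (h0 : ∀ x ∈ sphere (0 : E) R, w x = 0) :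
    LipschitzWith K ((closedBall (0:E) R).indicator w) := by
  have key : ∀ x y : E, x ∈ closedBall (0:E) R → y ∉ closedBall (0:E) R →
      ‖w x‖ ≤ K * dist x y := by
    intro x y hx hy
    have hc : ContinuousOn (fun z : E => ‖z‖) (segment ℝ x y) := by fun_prop
    have hR : R ∈ Icc ‖x‖ ‖y‖ := by
      simp at hx hy
      exact ⟨hx, hy.le⟩
    obtain ⟨z, hz, hzR⟩ := (convex_segment x y).isPreconnected.intermediate_value
      (left_mem_segment ℝ x y) (right_mem_segment ℝ x y) hc hR
    have hz' : z ∈ sphere (0:E) R := by simpa using hzR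
    have h1 := hw.dist_le_mul x hx z (sphere_subset_closedBall hz')
    rw [h0 z hz', dist_zero_right] at h1
    refine h1.trans ?_
    have := dist_add_dist_of_mem_segment hz
    have := dist_nonneg (x := z) (y := y)
    gcongr
    linarith
  refine LipschitzWith.of_dist_le_mul fun x y => ?_
  by_cases hx : x ∈ closedBall (0:E) R <;> by_cases hy : y ∈ closedBall (0:E) R
  · rw [indicator_of_mem hx, indicator_of_mem hy]; exact hw.dist_le_mul x hx y hy
  · rw [indicator_of_mem hx, indicator_of_notMem hy, dist_zero_right]; exact key x y hx hy
  · rw [indicator_of_notMem hx, indicator_of_mem hy, dist_zero_left, dist_comm]; exact key y x hy hx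
  · rw [indicator_of_notMem hx, indicator_of_notMem hy]; simp; positivity

theorem aux_interp {n : ℕ} (v : ℕ → ℝ) (hv : Function.Injective v)
    (A : EuclideanSpace ℝ (Fin n) →L[ℝ] EuclideanSpace ℝ (Fin n)) :
    (1 + A).det = ∑ i ∈ Finset.range (n+1),
      (1 + v i • A).det * (Lagrange.basis (Finset.range (n+1)) v i).eval 1 := by
  classical
  let b := (EuclideanSpace.basisFun (Fin n) ℝ).toBasis
  let M := LinearMap.toMatrix b b (A : EuclideanSpace ℝ (Fin n) →ₗ[ℝ] EuclideanSpace ℝ (Fin n))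
  let p : Polynomial ℝ := Matrix.det ((Polynomial.X : Polynomial ℝ) • M.map Polynomial.C
    + (1 : Matrix (Fin n) (Fin n) ℝ).map Polynomial.C)
  have hp : ∀ t : ℝ, p.eval t = (1 + t • A).det := by
    intro t
    have h1 : (1 + t • A).det = Matrix.det (1 + t • M) := by
      show LinearMap.det _ = _
      rw [← LinearMap.det_toMatrix b]
      congr 1
      simp [M, LinearMap.toMatrix_one]
    rw [h1]
    show Polynomial.eval t (Matrix.det _) = _
    rw [← Polynomial.coe_evalRingHom, RingHom.map_det]
    congr 1
    ext i j
    by_cases h : i = j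
    · simp [h]; ring
    · simp [h]; ring
  have hdeg : p.degree < (Finset.range (n+1)).card := by
    have := Polynomial.natDegree_det_X_add_C_le M 1
    simp only [Fintype.card_fin] at this
    refine lt_of_le_of_lt Polynomial.degree_le_natDegree ?_
    rw [Finset.card_range]
    exact_mod_cast Nat.lt_succ_of_le this
  have h := Lagrange.eq_interpolate (hv.injOn (s := ↑(Finset.range (n+1)))) hdeg
  have h2 := hp 1
  rw [one_smul] at h2
  rw [← h2]
  conv_lhs => rw [h]
  rw [Lagrange.interpolate_apply, Polynomial.eval_finsetSum]
  refine Finset.sum_congr rfl fun i _ => ?_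
  simp [hp]

/-- Smooth no-retraction. -/
theorem aux_smooth {n : ℕ} (R : ℝ) (hR : 0 < R)
    (h : EuclideanSpace ℝ (Fin n) → EuclideanSpace ℝ (Fin n))
    (hs : ContDiff ℝ 1 h) (hn : ∀ x, ‖h x‖ = R)
    (hb : ∀ x ∈ sphere (0 : EuclideanSpace ℝ (Fin n)) R, h x = x) : False := by
  let w : (EuclideanSpace ℝ (Fin n)) → (EuclideanSpace ℝ (Fin n)) := fun x => h x - x
  have hw : ContDiff ℝ 1 w := hs.sub contDiff_id
  have hwc : Continuous (fderiv ℝ w) := hw.continuous_fderiv (by norm_num)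
  have hwd : Differentiable ℝ w := hw.differentiable (by norm_num)
  -- bound on the derivative
  obtain ⟨K, hK⟩ : ∃ K : NNReal, ∀ x ∈ closedBall (0:(EuclideanSpace ℝ (Fin n))) R, ‖fderiv ℝ w x‖₊ ≤ K := by
    obtain ⟨C, hC⟩ := (isCompact_closedBall (0:(EuclideanSpace ℝ (Fin n))) R).exists_bound_of_continuousOn hwc.continuousOn
    refine ⟨C.toNNReal, fun x hx => ?_⟩
    rw [← NNReal.coe_le_coe]
    exact (hC x hx).trans (Real.le_coe_toNNReal C)
  have hwL : LipschitzOnWith K w (closedBall 0 R) :=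
    (convex_closedBall (0:(EuclideanSpace ℝ (Fin n))) R).lipschitzOnWith_of_nnnorm_fderiv_le (fun x _ => hwd x) hK
  have hw0 : ∀ x ∈ sphere (0 : (EuclideanSpace ℝ (Fin n))) R, w x = 0 := fun x hx => by simp [w, hb x hx]
  have hL := aux_lip w R K hwL hw0
  -- det positivity near 1
  obtain ⟨δ, hδ, hdet⟩ : ∃ δ > 0, ∀ A : (EuclideanSpace ℝ (Fin n)) →L[ℝ] (EuclideanSpace ℝ (Fin n)), ‖A‖ < δ → 0 < (1 + A).det := by
    have hc : Continuous fun A : (EuclideanSpace ℝ (Fin n)) →L[ℝ] (EuclideanSpace ℝ (Fin n)) => (1 + A).det :=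
      ContinuousLinearMap.continuous_det.comp (by fun_prop)
    have h1 : (0:ℝ) < ((1 : (EuclideanSpace ℝ (Fin n)) →L[ℝ] (EuclideanSpace ℝ (Fin n))) + 0).det := by
      rw [add_zero]
      show (0:ℝ) < LinearMap.det (LinearMap.id : (EuclideanSpace ℝ (Fin n)) →ₗ[ℝ] (EuclideanSpace ℝ (Fin n)))
      simp
    obtain ⟨δ, hδ, h⟩ := Metric.eventually_nhds_iff.1 (hc.continuousAt.eventually (lt_mem_nhds h1))
    exact ⟨δ, hδ, fun A hA => h (by simpa using hA)⟩
  -- main volume identity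
  have hvol : ∀ s : ℝ, 0 ≤ s → s * K < 1 → s * K < δ →
      ∫ x in ball (0:(EuclideanSpace ℝ (Fin n))) R, (1 + s • fderiv ℝ w x).det = (volume (ball (0:(EuclideanSpace ℝ (Fin n))) R)).toReal := by
    intro s hs0 hs1 hs2
    let u : (EuclideanSpace ℝ (Fin n)) → (EuclideanSpace ℝ (Fin n)) := fun x => s • (closedBall (0:(EuclideanSpace ℝ (Fin n))) R).indicator w x
    have hbij : Function.Bijective (fun x => x + u x) := by
      refine aux_contract u (s.toNNReal * K) ?_ ?_
      · rw [← NNReal.coe_lt_coe]; simpa [Real.coe_toNNReal s hs0] using hs1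
      · refine LipschitzWith.of_dist_le_mul fun x y => ?_
        have := hL.dist_le_mul x y
        simp only [u, dist_smul₀, NNReal.coe_mul, Real.coe_toNNReal s hs0, Real.norm_eq_abs,
          abs_of_nonneg hs0, mul_assoc]
        gcongr
    have hout : ∀ x ∉ ball (0:(EuclideanSpace ℝ (Fin n))) R, x + u x = x := by
      intro x hx
      by_cases hx' : x ∈ closedBall (0:(EuclideanSpace ℝ (Fin n))) R
      · have : x ∈ sphere (0:(EuclideanSpace ℝ (Fin n))) R := by
          simp at hx hx' ⊢; linarith
        simp [u, hx', hw0 x this]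
      · simp [u, hx']
    have himg : (fun x => x + u x) '' ball (0:(EuclideanSpace ℝ (Fin n))) R = ball 0 R := by
      ext y
      constructor
      · rintro ⟨x, hx, rfl⟩
        by_contra hy
        have h2 : (x + u x) = x := hbij.1 (hout _ hy)
        exact hy (by simpa only [h2] using hx)
      · intro hy
        obtain ⟨x, hx⟩ := hbij.2 y
        refine ⟨x, ?_, hx⟩
        by_contra hx'
        have : x + u x = y := hx
        rw [hout x hx'] at this
        exact hx' (this ▸ hy)
    have hder : ∀ x ∈ ball (0:(EuclideanSpace ℝ (Fin n))) R, HasFDerivWithinAt (fun x => x + u x)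
        (1 + s • fderiv ℝ w x) (ball 0 R) x := by
      intro x hx
      have h1 : HasFDerivAt (fun x => x + s • w x) (1 + s • fderiv ℝ w x) x :=
        (hasFDerivAt_id x).add ((hwd x).hasFDerivAt.const_smul s)
      refine h1.hasFDerivWithinAt.congr (fun y hy => ?_) ?_
      · simp only [u]; rw [indicator_of_mem (ball_subset_closedBall hy)]
      · simp only [u]; rw [indicator_of_mem (ball_subset_closedBall hx)]
    have hcv := lintegral_abs_det_fderiv_eq_addHaar_image volume measurableSet_ball hder hbij.1.injOn
    rw [himg] at hcv
    have hpos : ∀ x ∈ ball (0:(EuclideanSpace ℝ (Fin n))) R, 0 < (1 + s • fderiv ℝ w x).det := by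
      intro x hx
      apply hdet
      have := hK x (ball_subset_closedBall hx)
      rw [← NNReal.coe_le_coe, coe_nnnorm] at this
      rw [norm_smul, Real.norm_eq_abs, abs_of_nonneg hs0]
      refine lt_of_le_of_lt ?_ hs2
      gcongr
    have hcd : Continuous fun x => (1 + s • fderiv ℝ w x).det :=
      ContinuousLinearMap.continuous_det.comp (by fun_prop)
    rw [integral_eq_lintegral_of_nonneg_ae, ← hcv]
    · congr 1
      refine setLIntegral_congr_fun measurableSet_ball fun x hx => ?_
      simp only [abs_of_pos (hpos x hx)]
    · refine (ae_restrict_iff' measurableSet_ball).2 (Filter.Eventually.of_forall fun x hx => ?_)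
      exact (hpos x hx).le
    · exact hcd.aestronglyMeasurable
  -- nodes
  obtain ⟨c, hc0, hc1, hc2⟩ : ∃ c : ℝ, 0 < c ∧ c * K < 1 ∧ c * K < δ := by
    refine ⟨min 1 δ / (K + 1) , by positivity, ?_, ?_⟩
    · rw [div_mul_eq_mul_div, div_lt_iff₀ (by positivity)]
      have : min 1 δ ≤ 1 := min_le_left _ _
      nlinarith [K.2]
    · rw [div_mul_eq_mul_div, div_lt_iff₀ (by positivity)]
      have : min 1 δ ≤ δ := min_le_right _ _
      nlinarith [K.2]
  let v : ℕ → ℝ := fun i => c / (i + 1)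
  have hv : Function.Injective v := by
    intro i j hij
    simp only [v] at hij
    rw [div_eq_div_iff (by positivity) (by positivity)] at hij
    have := mul_left_cancel₀ hc0.ne' hij
    exact_mod_cast (add_right_cancel this).symm
  have hvle : ∀ i, v i ≤ c := fun i => div_le_self hc0.le (by linarith [i.cast_nonneg (α := ℝ)])
  have hv0 : ∀ i, 0 ≤ v i := fun i => by positivity
  have hvi : ∀ i, ∫ x in ball (0:(EuclideanSpace ℝ (Fin n))) R, (1 + v i • fderiv ℝ w x).det
      = (volume (ball (0:(EuclideanSpace ℝ (Fin n))) R)).toReal := fun i =>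
    hvol _ (hv0 i) (lt_of_le_of_lt (by gcongr; exact hvle i) hc1)
      (lt_of_le_of_lt (by gcongr; exact hvle i) hc2)
  have hint : ∀ i, Integrable (fun x => (1 + v i • fderiv ℝ w x).det)
      (volume.restrict (ball (0:(EuclideanSpace ℝ (Fin n))) R)) := by
    intro i
    have hcd : Continuous fun x => (1 + v i • fderiv ℝ w x).det :=
      ContinuousLinearMap.continuous_det.comp (by fun_prop)
    exact (hcd.continuousOn.integrableOn_compact (isCompact_closedBall (0:(EuclideanSpace ℝ (Fin n))) R)).mono_set
      ball_subset_closedBall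
  have htot : ∫ x in ball (0:(EuclideanSpace ℝ (Fin n))) R, (1 + fderiv ℝ w x).det = (volume (ball (0:(EuclideanSpace ℝ (Fin n))) R)).toReal := by
    rw [integral_congr_ae (Filter.Eventually.of_forall fun x => aux_interp v hv (fderiv ℝ w x))]
    rw [integral_finsetSum _ (fun i _ => (hint i).mul_const _)]
    simp_rw [integral_mul_const, hvi]
    rw [← Finset.mul_sum, ← Polynomial.eval_finsetSum, Lagrange.sum_basis hv.injOn (by simp)]
    simp
  have hzero : ∀ x, (1 + fderiv ℝ w x).det = 0 := by
    intro x
    have hd : DifferentiableAt ℝ h x := hs.differentiable (by norm_num) x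
    have e1 : 1 + fderiv ℝ w x = fderiv ℝ h x := by
      have : fderiv ℝ w x = fderiv ℝ h x - 1 := 
        (hd.hasFDerivAt.sub (hasFDerivAt_id x)).fderiv
      rw [this]; abel
    rw [e1]
    by_contra hne
    have hsurj : Function.Surjective (fderiv ℝ h x) := by
      have := (LinearMap.equivOfDetNeZero _ hne).surjective
      exact this
    obtain ⟨y, hy⟩ := hsurj (h x)
    have hk : HasFDerivAt (fun x => inner ℝ (h x) (h x)) _ x := hd.hasFDerivAt.inner ℝ hd.hasFDerivAt
    have hk2 : HasFDerivAt (fun x => inner ℝ (h x) (h x)) (0 : (EuclideanSpace ℝ (Fin n)) →L[ℝ] ℝ) x := by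
      have : (fun x => inner ℝ (h x) (h x)) = fun _ : (EuclideanSpace ℝ (Fin n)) => R^2 := by
        funext z; rw [real_inner_self_eq_norm_sq, hn]
      rw [this]; exact hasFDerivAt_const _ _
    have := congrArg (fun L : (EuclideanSpace ℝ (Fin n)) →L[ℝ] ℝ => L y) (hk.unique hk2)
    simp [hy, hn] at this
    exact hR.ne' this
  simp_rw [hzero] at htot
  rw [integral_zero] at htot
  have : 0 < (volume (ball (0:(EuclideanSpace ℝ (Fin n))) R)).toReal :=
    ENNReal.toReal_pos (measure_ball_pos volume _ hR).ne' measure_ball_lt_top.ne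
  linarith

theorem aux_cont {n : ℕ} (R ε : ℝ) (hR : 0 < R) (hε : 0 < ε)
    (g : EuclideanSpace ℝ (Fin n) → EuclideanSpace ℝ (Fin n))
    (hg : Continuous g) (hgε : ∀ x, ε ≤ ‖g x‖)
    (hb : ∀ x, R ≤ ‖x‖ → g x = x) : False := by
  classical
  let t : (EuclideanSpace ℝ (Fin n)) → Set (EuclideanSpace ℝ (Fin n)) := fun x => if R + 1 ≤ ‖x‖ then {0} else ball (g x - x) ε
  have ht : ∀ x, Convex ℝ (t x) := by
    intro x
    simp only [t]
    split_ifs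
    · exact convex_singleton 0
    · exact convex_ball _ _
  have hloc : ∀ x : (EuclideanSpace ℝ (Fin n)), ∃ c : (EuclideanSpace ℝ (Fin n)), ∀ᶠ y in 𝓝 x, c ∈ t y := by
    intro x
    by_cases hx : ‖x‖ < R + 1
    · refine ⟨g x - x, ?_⟩
      have h1 : ∀ᶠ y in 𝓝 x, ‖y‖ < R + 1 := continuous_norm.continuousAt.eventually (gt_mem_nhds hx)
      have hc : ContinuousAt (fun y => g y - y) x := (hg.sub continuous_id).continuousAt
      have h2 : ∀ᶠ y in 𝓝 x, g y - y ∈ ball (g x - x) ε := hc (ball_mem_nhds _ hε)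
      filter_upwards [h1, h2] with y hy1 hy2
      simp only [t, not_le.2 hy1, if_false]
      exact mem_ball_comm.1 hy2
    · refine ⟨0, ?_⟩
      have h1 : ∀ᶠ y in 𝓝 x, R < ‖y‖ :=
        continuous_norm.continuousAt.eventually (lt_mem_nhds (by linarith))
      filter_upwards [h1] with y hy1
      simp only [t]
      split_ifs
      · rfl
      · simp [hb y hy1.le, hε]
  obtain ⟨v, hv⟩ := exists_contMDiffMap_forall_mem_convex_of_local_const
    (n := ((1 : ℕ) : ℕ∞)) (modelWithCornersSelf ℝ (EuclideanSpace ℝ (Fin n))) ht hloc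
  have hvs : ContDiff ℝ 1 (v : (EuclideanSpace ℝ (Fin n)) → (EuclideanSpace ℝ (Fin n))) := v.contMDiff.contDiff
  let G : (EuclideanSpace ℝ (Fin n)) → (EuclideanSpace ℝ (Fin n)) := fun x => x + v x
  have hGs : ContDiff ℝ 1 G := contDiff_id.add hvs
  have hGout : ∀ x, R + 1 ≤ ‖x‖ → G x = x := by
    intro x hx
    have := hv x
    simp only [t, hx, if_true, mem_singleton_iff] at this
    simp [G, this]
  have hG0 : ∀ x, G x ≠ 0 := by
    intro x
    by_cases hx : R + 1 ≤ ‖x‖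
    · rw [hGout x hx]
      intro h0
      rw [h0, norm_zero] at hx
      linarith
    · have := hv x
      simp only [t, hx, if_false, mem_ball, dist_eq_norm] at this
      intro h0
      have e : v x - (g x - x) = - g x := by
        have : x + v x = 0 := h0
        rw [eq_neg_of_add_eq_zero_right this]; abel
      rw [e, norm_neg] at this
      linarith [hgε x]
  have hR1 : 0 < R + 1 := by linarith
  refine aux_smooth (R + 1) hR1 (fun x => ((R + 1) / ‖G x‖) • G x) ?_ ?_ ?_
  · exact (contDiff_const.div (hGs.norm ℝ hG0) (fun x => norm_ne_zero_iff.2 (hG0 x))).smul hGs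
  · intro x
    have := norm_ne_zero_iff.2 (hG0 x)
    rw [norm_smul, norm_div, norm_norm, Real.norm_of_nonneg hR1.le]
    field_simp
  · intro x hx
    have hx' : ‖x‖ = R + 1 := by simpa using hx
    simp only [hGout x hx'.ge, hx', div_self hR1.ne', one_smul]

theorem aux_outside {n : ℕ} (hn : 2 ≤ n) :
    IsPreconnected {x : EuclideanSpace ℝ (Fin n) | 1 ≤ ‖x‖} := by
  have hr : 1 < Module.rank ℝ (EuclideanSpace ℝ (Fin n)) := by
    rw [← Module.finrank_eq_rank, finrank_euclideanSpace_fin]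
    exact_mod_cast hn
  have h := (isConnected_compl_singleton_of_one_lt_rank hr 0).isPreconnected.image
    (fun x => (max 1 ‖x‖ / ‖x‖) • x) (by
      refine ContinuousOn.smul (ContinuousOn.div (Continuous.continuousOn (continuous_const.max continuous_norm)) continuous_norm.continuousOn ?_) continuousOn_id
      intro x hx
      exact norm_ne_zero_iff.2 hx)
  convert h using 1
  ext x
  constructor
  · intro hx
    have hx : 1 ≤ ‖x‖ := hx
    refine ⟨x, ?_, ?_⟩
    · intro h0
      rw [mem_singleton_iff.1 h0, norm_zero] at hx
      linarith
    · simp only [max_eq_right hx]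
      rw [div_self (by linarith), one_smul]
  · rintro ⟨y, hy, rfl⟩
    have hy : ‖y‖ ≠ 0 := norm_ne_zero_iff.2 hy
    show 1 ≤ ‖_‖
    rw [norm_smul, norm_div, norm_norm, Real.norm_of_nonneg (by positivity), div_mul_cancel₀ _ hy]
    exact le_max_left _ _

theorem aux_compl {n : ℕ} (hn : 2 ≤ n) (Y : Set (EuclideanSpace ℝ (Fin n)))
    (hY : IsClosed Y) (hYint : Y ⊆ ball 0 1)
    (r : EuclideanSpace ℝ (Fin n) → EuclideanSpace ℝ (Fin n)) (hr : Continuous r)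
    (hrY : ∀ x ∈ closedBall (0 : EuclideanSpace ℝ (Fin n)) 1, r x ∈ Y) (hfix : ∀ y ∈ Y, r y = y) :
    IsPreconnected Yᶜ := by
  classical
  have hA := aux_outside hn
  have hAY : {x : (EuclideanSpace ℝ (Fin n)) | 1 ≤ ‖x‖} ⊆ Yᶜ := by
    intro x hx hxY
    have := hYint hxY
    rw [mem_ball_zero_iff] at this
    exact absurd hx (not_le.2 this)
  have key : ∀ p ∈ Yᶜ, ∃ q ∈ connectedComponentIn Yᶜ p, 1 ≤ ‖q‖ := by
    intro p hp
    by_contra! hcon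
    set U := connectedComponentIn Yᶜ p with hU
    have hUo : IsOpen U := hY.isOpen_compl.connectedComponentIn
    have hpU : p ∈ U := mem_connectedComponentIn hp
    have hUY : U ⊆ Yᶜ := connectedComponentIn_subset _ _
    have hfr : ∀ x ∈ frontier U, x ∈ Y := by
      intro x hx
      by_contra hxY
      have hVo : IsOpen (connectedComponentIn Yᶜ x) := hY.isOpen_compl.connectedComponentIn
      have hxV : x ∈ connectedComponentIn Yᶜ x := mem_connectedComponentIn hxY
      obtain ⟨z, hz1, hz2⟩ := mem_closure_iff.1 hx.1 _ hVo hxV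
      have e1 := connectedComponentIn_eq hz1
      have e2 := connectedComponentIn_eq hz2
      rw [e1, ← e2] at hxV
      exact hx.2 (by rw [hUo.interior_eq]; exact hxV)
    let g : (EuclideanSpace ℝ (Fin n)) → (EuclideanSpace ℝ (Fin n)) := fun x => if x ∈ U then r x else x
    have hg : Continuous g := by
      refine Continuous.if (fun a ha => ?_) hr continuous_id
      exact hfix a (hfr a ha)
    have hgU : ∀ x, g x ∉ U := by
      intro x
      simp only [g]
      split_ifs with hx
      · intro h
        refine hUY h (hrY x ?_)
        rw [mem_closedBall_zero_iff]
        exact (hcon x hx).le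
      · exact hx
    obtain ⟨ε, hε, hball⟩ := Metric.isOpen_iff.1 hUo p hpU
    refine aux_cont (n := n) (1 + ‖p‖) ε (by positivity) hε (fun x => g (x + p) - p)
      (by fun_prop) ?_ ?_
    · intro x
      by_contra! hlt
      exact hgU (x + p) (hball (by rwa [mem_ball, dist_eq_norm]))
    · intro x hx
      have : x + p ∉ U := by
        intro h
        have h1 := hcon _ h
        have h2 := norm_sub_le (x + p) p
        rw [add_sub_cancel_right] at h2
        linarith
      simp [g, this]
  have hn0 : Nontrivial (EuclideanSpace ℝ (Fin n)) := by
    have : Nonempty (Fin n) := ⟨⟨0, by omega⟩⟩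
    infer_instance
  obtain ⟨s, hs⟩ := exists_norm_eq (EuclideanSpace ℝ (Fin n)) (zero_le_one (α := ℝ))
  have hall : Yᶜ = connectedComponentIn Yᶜ s := by
    refine Subset.antisymm (fun p hp => ?_) (connectedComponentIn_subset _ _)
    obtain ⟨q, hq, hq1⟩ := key p hp
    have hqs : q ∈ connectedComponentIn Yᶜ s :=
      hA.subset_connectedComponentIn (show 1 ≤ ‖s‖ from hs.ge) hAY hq1
    rw [connectedComponentIn_eq hqs, ← connectedComponentIn_eq hq]
    exact mem_connectedComponentIn hp
  rw [hall]
  exact isPreconnected_connectedComponentIn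


/-- Let `Y` be a compact subset of the interior of the closed unit ball `Dⁿ ⊆ ℝⁿ`
(`n ≥ 2`) such that `Dⁿ` deformation retracts onto `Y` (via a homotopy `H` with
`H 0 = id`, `H 1` having image `Y`, fixing `Y` pointwise and preserving `Dⁿ`).
Then `Y` is connected and the complement `Dⁿ \ Y` is connected. -/
theorem spine_and_complement_connected
    (n : ℕ) (hn : 2 ≤ n)
    (Y : Set (EuclideanSpace ℝ (Fin n)))
    (hYcompact : IsCompact Y)
    (hYint : Y ⊆ Metric.ball (0 : EuclideanSpace ℝ (Fin n)) 1)
    (H : ℝ → EuclideanSpace ℝ (Fin n) → EuclideanSpace ℝ (Fin n))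
    (hHcont : Continuous (fun p : ℝ × EuclideanSpace ℝ (Fin n) => H p.1 p.2))
    (hHmaps : ∀ t ∈ Set.Icc (0:ℝ) 1, ∀ x ∈ Metric.closedBall (0 : EuclideanSpace ℝ (Fin n)) 1,
      H t x ∈ Metric.closedBall (0 : EuclideanSpace ℝ (Fin n)) 1)
    (hH0 : ∀ x ∈ Metric.closedBall (0 : EuclideanSpace ℝ (Fin n)) 1, H 0 x = x)
    (hH1 : H 1 '' Metric.closedBall (0 : EuclideanSpace ℝ (Fin n)) 1 = Y)
    (hfix : ∀ t ∈ Set.Icc (0:ℝ) 1, ∀ y ∈ Y, H t y = y) :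
    IsConnected Y ∧
      IsConnected (Metric.closedBall (0 : EuclideanSpace ℝ (Fin n)) 1 \ Y) := by
  classical
  have hr : Continuous (H 1) := hHcont.comp (by fun_prop : Continuous fun x => ((1:ℝ), x))
  have hrY : ∀ x ∈ closedBall (0 : EuclideanSpace ℝ (Fin n)) 1, H 1 x ∈ Y :=
    fun x hx => hH1 ▸ mem_image_of_mem _ hx
  have hc := aux_compl hn Y hYcompact.isClosed hYint (H 1) hr hrY
    (hfix 1 ⟨zero_le_one, le_rfl⟩)
  constructor
  · rw [← hH1]
    exact (isConnected_closedBall zero_le_one).image _ hr.continuousOn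
  have hn0 : Nontrivial (EuclideanSpace ℝ (Fin n)) := by
    have : Nonempty (Fin n) := ⟨⟨0, by omega⟩⟩
    infer_instance
  obtain ⟨s, hs⟩ := exists_norm_eq (EuclideanSpace ℝ (Fin n)) (zero_le_one (α := ℝ))
  have hout : ∀ x : EuclideanSpace ℝ (Fin n), 1 ≤ ‖x‖ → x ∉ Y := by
    intro x hx hxY
    have := hYint hxY
    rw [mem_ball_zero_iff] at this
    linarith
  refine ⟨⟨s, by simp [hs], hout s hs.ge⟩, ?_⟩
  have hcont : Continuous fun x : EuclideanSpace ℝ (Fin n) => (max 1 ‖x‖)⁻¹ • x := by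
    refine Continuous.smul (Continuous.inv₀ (continuous_const.max continuous_norm) fun x => ?_) continuous_id
    have := le_max_left 1 ‖x‖
    linarith
  convert hc.image _ hcont.continuousOn using 1
  ext x
  constructor
  · rintro ⟨hx, hxY⟩
    rw [mem_closedBall_zero_iff] at hx
    exact ⟨x, hxY, by simp [max_eq_left hx]⟩
  · rintro ⟨y, hyY, rfl⟩
    by_cases hy : ‖y‖ ≤ 1
    · simp only [max_eq_left hy, inv_one, one_smul]
      exact ⟨by rwa [mem_closedBall_zero_iff], hyY⟩
    · have hy := (not_le.1 hy).le
      have h1 : ‖(max 1 ‖y‖)⁻¹ • y‖ = 1 := by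
        rw [max_eq_right hy, norm_smul, norm_inv, norm_norm, inv_mul_cancel₀ (by linarith)]
      exact ⟨by rw [mem_closedBall_zero_iff]; exact h1.le, hout _ h1.ge⟩
end
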